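/- Fix an integer n ≥ 4 and a > 0, and set μ(x) = 1 − a xⁿ. Then for all sufficiently small x_b > 0 the solution t(x) of the outgoing radial null geodesic equation t′(x) = r_x(t(x), x) with t(x_b) = t₀(x_b) extends backwards to all of (0, x_b], satisfies t(x) < t_h(x) for every x ∈ (0, x_b], and the limit L = lim_{x→0⁺} t(x) exists and satisfies L < 1 = t_s(0); that is, the photon surface extension terminates at the regular centre strictly before the central singularity forms. -/

import Mathlib

/-- Mass profile function `μ(x) = 1 - a xⁿ` of the marginally bound LTB collapse. -/
noncomputable def muf (a : ℝ) (n : ℕ) (x : ℝ) : ℝ := 1 - a * x ^ n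

/-- Singularity time `t_s(x) = 1/μ(x)`. -/
noncomputable def tsf (a : ℝ) (n : ℕ) (x : ℝ) : ℝ := 1 / muf a n x

/-- Area radius `r(t,x) = x (1 - μ(x) t)^{2/3}`. -/
noncomputable def rf (a : ℝ) (n : ℕ) (t x : ℝ) : ℝ :=
  x * (1 - muf a n x * t) ^ ((2 : ℝ) / 3)

/-- Apparent horizon curve `t_h(x) = (1/μ(x))(1 - (8/27) μ(x)³ x³)`. -/
noncomputable def thf (a : ℝ) (n : ℕ) (x : ℝ) : ℝ :=
  (1 / muf a n x) * (1 - 8 / 27 * (muf a n x) ^ 3 * x ^ 3)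

/-- Photon-sphere matching time `t₀(x) = (1/μ(x))(1 - (2/3)^{3/2} μ(x)³ x³)`,
defined by `r(t₀(x), x) = 3 m(x)`. -/
noncomputable def t0f (a : ℝ) (n : ℕ) (x : ℝ) : ℝ :=
  (1 / muf a n x) * (1 - (2 / 3 : ℝ) ^ ((3 : ℝ) / 2) * (muf a n x) ^ 3 * x ^ 3)

open Set Metric in
/-- The Picard–Lindelöf theorem, recording that the solution stays in the closed ball. -/
lemma IsPicardLindelof.exists_mem_closedBall_hasDerivWithinAt {E : Type*} [NormedAddCommGroup E]
    [NormedSpace ℝ E] [CompleteSpace E] {f : ℝ → E → E} {tmin tmax : ℝ} {t₀ : Icc tmin tmax}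
    {x₀ : E} {a L K : NNReal} (hf : IsPicardLindelof f t₀ x₀ a 0 L K) :
    ∃ α : ℝ → E, α t₀ = x₀ ∧ ∀ t ∈ Icc tmin tmax,
      α t ∈ closedBall x₀ a ∧ HasDerivWithinAt α (f t (α t)) (Icc tmin tmax) t := by
  obtain ⟨α, hα⟩ := ODE.FunSpace.exists_isFixedPt_next hf (mem_closedBall_self le_rfl)
  refine ⟨α.compProj, by rw [ODE.FunSpace.compProj_val, ← hα, ODE.FunSpace.next_apply₀],
    fun t ht => ⟨α.compProj_mem_closedBall hf.mul_max_le, ?_⟩⟩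
  apply ODE.hasDerivWithinAt_picard_Icc t₀.2 hf.continuousOn_uncurry
    α.continuous_compProj.continuousOn (fun _ _ => α.compProj_mem_closedBall hf.mul_max_le)
    x₀ ht |>.congr_of_mem _ ht
  intro t' ht'
  nth_rw 1 [← hα]
  rw [ODE.FunSpace.compProj_of_mem ht', ODE.FunSpace.next_apply]

open Set Metric Function in
/-- Picard–Lindelöf on a rectangle, integrating backwards from the right endpoint; the solution
stays in the rectangle. -/
lemma exists_backward_solution {f : ℝ → ℝ → ℝ} {b s₀ R L : ℝ} (hb : 0 ≤ b) (hL : 0 ≤ L)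
    (hf : ContDiffOn ℝ 1 (uncurry f) (Icc 0 b ×ˢ closedBall s₀ R))
    (hbound : ∀ x ∈ Icc 0 b, ∀ s ∈ closedBall s₀ R, ‖f x s‖ ≤ L) (hLR : L * b ≤ R) :
    ∃ s : ℝ → ℝ, s b = s₀ ∧ ∀ x ∈ Icc 0 b,
      s x ∈ closedBall s₀ R ∧ HasDerivWithinAt s (f x (s x)) (Icc 0 b) x := by
  have hR : 0 ≤ R := (mul_nonneg hL hb).trans hLR
  obtain ⟨K, hK⟩ := hf.exists_lipschitzOnWith one_ne_zero
    ((convex_Icc 0 b).prod (convex_closedBall s₀ R))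
    (isCompact_Icc.prod (isCompact_closedBall s₀ R))
  have hlip : ∀ x ∈ Icc 0 b, LipschitzOnWith K (f x) (closedBall s₀ R) := by
    intro x hx s hs s' hs'
    simpa [uncurry, Prod.edist_eq] using hK (mk_mem_prod hx hs) (mk_mem_prod hx hs')
  have hpl : IsPicardLindelof f (⟨b, hb, le_rfl⟩ : Icc (0 : ℝ) b) s₀ ⟨R, hR⟩ 0 ⟨L, hL⟩ K :=
    ⟨hlip, fun s hs => hf.continuousOn.comp (f := fun x : ℝ => (x, s)) (by fun_prop)
        fun x hx => mk_mem_prod hx hs, hbound, by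
      change L * max (b - b) (b - 0) ≤ R - 0
      rwa [sub_self, sub_zero, sub_zero, max_eq_right hb]⟩
  obtain ⟨α, hα₀, hα⟩ := hpl.exists_mem_closedBall_hasDerivWithinAt
  exact ⟨α, hα₀, hα⟩

/-- The null geodesic equation written for `s = (1 - μ t)^{1/3}`: `s' = cbrtField a n x s`. -/
noncomputable def cbrtField (a : ℝ) (n : ℕ) (x s : ℝ) : ℝ :=
  -(muf a n x) / 3 - 2 / 9 * (a * n * x ^ n) * (s⁻¹ ^ 3 - 1) +
    a * n * x ^ (n - 1) / (3 * muf a n x) * (s⁻¹ ^ 2 - s)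

lemma muf_mem_Icc {a b x : ℝ} {n : ℕ} (hn : 4 ≤ n) (ha : 0 < a) (hb : b ≤ 1 / 2)
    (hab : a * n * b ≤ 1 / 100) (hx : 0 ≤ x) (hxb : x ≤ b) :
    99 / 100 ≤ muf a n x ∧ muf a n x ≤ 1 := by
  have hn' : (4 : ℝ) ≤ n := by exact_mod_cast hn
  have h1 : x ^ n ≤ x := pow_le_of_le_one hx (by linarith) (by omega)
  have h2 : a * x ^ n ≤ a * b := by gcongr; linarith
  have h3 : a * b ≤ a * n * b := by
    have : 0 ≤ a * b := mul_nonneg ha.le (hx.trans hxb)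
    nlinarith
  have h4 : 0 ≤ a * x ^ n := by positivity
  unfold muf
  constructor <;> linarith

lemma cbrtField_mem_Icc {a b x s : ℝ} {n : ℕ} (hn : 4 ≤ n) (ha : 0 < a) (hb₀ : 0 < b)
    (hb : b ≤ 1 / 2) (hab : a * n * b ≤ 1 / 100) (hx : 0 ≤ x) (hxb : x ≤ b)
    (hs : 2 / 5 * b ≤ s) (hs' : s ≤ 13 / 10 * b) :
    -(2 / 5) ≤ cbrtField a n x s ∧ cbrtField a n x s ≤ 0 := by
  obtain ⟨hμ, hμ'⟩ := muf_mem_Icc hn ha hb hab hx hxb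
  have hs₀ : 0 < s := by linarith
  have hs₁ : s ≤ 1 := by linarith
  have hc : 0 ≤ a * n := by positivity
  have hx₁ : x ≤ 1 := by linarith
  have hinv : s⁻¹ ≤ 5 / 2 * b⁻¹ := by
    rw [show 5 / 2 * b⁻¹ = (2 / 5 * b)⁻¹ by rw [mul_inv]; norm_num]
    exact inv_anti₀ (by positivity) hs
  have hinv₁ : 1 ≤ s⁻¹ := (one_le_inv₀ hs₀).2 hs₁
  have hpow : x ^ n ≤ b ^ 4 :=
    (pow_le_pow_of_le_one hx hx₁ hn).trans (pow_le_pow_left₀ hx hxb 4)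
  have hpow' : x ^ (n - 1) ≤ b ^ 3 :=
    (pow_le_pow_of_le_one hx hx₁ (by omega)).trans (pow_le_pow_left₀ hx hxb 3)
  have h3 : 0 ≤ s⁻¹ ^ 3 - 1 := sub_nonneg.2 (one_le_pow₀ hinv₁)
  have h3' : s⁻¹ ^ 3 - 1 ≤ (5 / 2 * b⁻¹) ^ 3 := by
    have : s⁻¹ ^ 3 ≤ (5 / 2 * b⁻¹) ^ 3 := by gcongr
    linarith
  have h2 : 0 ≤ s⁻¹ ^ 2 - s := by
    have := one_le_pow₀ hinv₁ (n := 2)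
    linarith
  have h2' : s⁻¹ ^ 2 - s ≤ (5 / 2 * b⁻¹) ^ 2 := by
    have : s⁻¹ ^ 2 ≤ (5 / 2 * b⁻¹) ^ 2 := by gcongr
    linarith
  have hA : 2 / 9 * (a * n * x ^ n) * (s⁻¹ ^ 3 - 1) ≤ 1 / 25 := by
    calc _ ≤ 2 / 9 * (a * n * b ^ 4) * (5 / 2 * b⁻¹) ^ 3 := by gcongr
      _ = 125 / 36 * (a * n * b) := by field_simp; ring
      _ ≤ _ := by linarith
  have hA₀ : 0 ≤ 2 / 9 * (a * n * x ^ n) * (s⁻¹ ^ 3 - 1) := by positivity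
  have hμ₀ : 0 < muf a n x := by linarith
  have hB : a * n * x ^ (n - 1) / (3 * muf a n x) * (s⁻¹ ^ 2 - s) ≤ 1 / 25 := by
    calc _ ≤ a * n * b ^ 3 / 2 * (5 / 2 * b⁻¹) ^ 2 := by gcongr; linarith
      _ = 25 / 8 * (a * n * b) := by field_simp; ring
      _ ≤ _ := by linarith
  have hB₀ : 0 ≤ a * n * x ^ (n - 1) / (3 * muf a n x) * (s⁻¹ ^ 2 - s) := by positivity
  unfold cbrtField
  constructor <;> linarith

lemma contDiffOn_cbrtField {a : ℝ} {n : ℕ} {S : Set (ℝ × ℝ)}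
    (h : ∀ p ∈ S, muf a n p.1 ≠ 0 ∧ p.2 ≠ 0) :
    ContDiffOn ℝ 1 (Function.uncurry (cbrtField a n)) S := by
  intro p hp
  obtain ⟨h₁, h₂⟩ := h p hp
  have hinv : ContDiffAt ℝ 1 (fun q : ℝ × ℝ => q.2⁻¹) p := contDiffAt_snd.inv h₂
  have hμ : ContDiffAt ℝ 1 (fun q : ℝ × ℝ => muf a n q.1) p := by unfold muf; fun_prop
  have hμ' : ContDiffAt ℝ 1 (fun q : ℝ × ℝ => a * n * q.1 ^ (n - 1) / (3 * muf a n q.1)) p :=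
    ContDiffAt.div (by fun_prop) (by fun_prop) (mul_ne_zero three_ne_zero h₁)
  unfold Function.uncurry cbrtField
  exact ContDiffAt.contDiffWithinAt (by fun_prop)

lemma hasDerivAt_muf (a : ℝ) (n : ℕ) (x : ℝ) :
    HasDerivAt (muf a n) (-(a * (n * x ^ (n - 1)))) x :=
  ((hasDerivAt_pow n x).const_mul a).const_sub 1

lemma deriv_rf {a t x s : ℝ} {n : ℕ} (hs : 0 < s) (hst : 1 - muf a n x * t = s ^ 3) :
    deriv (fun y => rf a n t y) x = s ^ 2 + 2 / 3 * (a * n * x ^ (n - 1) * x) * t * s⁻¹ := by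
  have hcube (p : ℝ) : (s ^ 3) ^ p = s ^ (3 * p) := by
    rw [← Real.rpow_natCast, ← Real.rpow_mul hs.le]; norm_num
  have h := (hasDerivAt_id x).mul
    ((((hasDerivAt_muf a n x).mul_const t).const_sub 1).rpow_const (p := 2 / 3)
      (Or.inl (by rw [hst]; positivity)))
  refine (HasDerivAt.deriv (f := fun y => rf a n t y) h).trans ?_
  rw [hst, hcube, hcube, show (3 : ℝ) * (2 / 3) = (2 : ℕ) by norm_num,
    show (3 : ℝ) * (2 / 3 - 1) = -1 by norm_num, Real.rpow_natCast, Real.rpow_neg_one]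
  simp only [id]
  ring

lemma rpow_three_halves {c : ℝ} (hc : 0 ≤ c) : c ^ ((3 : ℝ) / 2) = √c ^ 3 := by
  rw [Real.sqrt_eq_rpow, ← Real.rpow_natCast, ← Real.rpow_mul hc]
  norm_num

lemma hasDerivWithinAt_of_cbrt {a x : ℝ} {n : ℕ} {s : ℝ → ℝ} {D : Set ℝ} (hn : n ≠ 0)
    (hμ : muf a n x ≠ 0) (hs : 0 < s x) (h : HasDerivWithinAt s (cbrtField a n x (s x)) D x) :
    HasDerivWithinAt (fun y => (1 - s y ^ 3) / muf a n y)
      (deriv (fun y => rf a n ((1 - s x ^ 3) / muf a n x) y) x) D x := by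
  rw [deriv_rf hs (by field_simp; ring)]
  refine (((h.pow 3).const_sub 1).div (hasDerivAt_muf a n x).hasDerivWithinAt hμ).congr_deriv ?_
  have hxn : x ^ n = x ^ (n - 1) * x := (pow_sub_one_mul hn x).symm
  simp only [cbrtField, hxn, Pi.pow_apply]
  field_simp
  ring

/-- Covered-singularity case of Theorem 4.1: for `n ≥ 4` the photon surface
extension (the outgoing radial null geodesic through `(t₀(x_b), x_b)`)
extends back on all of `(0, x_b]`, stays strictly below the apparent horizon,
and terminates at the regular centre: its limit `L` as `x → 0⁺` exists and
satisfies `L < 1 = t_s(0)`. -/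
theorem stmt_17 (n : ℕ) (hn : 4 ≤ n) (a : ℝ) (ha : 0 < a) :
    ∃ xbar > (0 : ℝ), ∀ xb : ℝ, 0 < xb → xb ≤ xbar →
      ∃ t : ℝ → ℝ, t xb = t0f a n xb ∧
        (∀ x : ℝ, 0 < x → x ≤ xb →
          HasDerivWithinAt t (deriv (fun x' => rf a n (t x) x') x) (Set.Ioc 0 xb) x ∧
          t x < thf a n x) ∧
        ∃ L : ℝ, Filter.Tendsto t (nhdsWithin 0 (Set.Ioi 0)) (nhds L) ∧
          L < 1 ∧ tsf a n 0 = 1 := by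
  have hn' : (4 : ℝ) ≤ n := by exact_mod_cast hn
  refine ⟨min (1 / 2) (1 / (100 * (a * n))), by positivity, fun b hb₀ hb => ?_⟩
  have hb₁ : b ≤ 1 / 2 := hb.trans (min_le_left _ _)
  have hab : a * n * b ≤ 1 / 100 := by
    calc a * n * b ≤ a * n * (1 / (100 * (a * n))) := by
          gcongr; exact hb.trans (min_le_right _ _)
      _ = 1 / 100 := by field_simp
  have hμ {x : ℝ} (hx : 0 ≤ x) (hxb : x ≤ b) := muf_mem_Icc hn ha hb₁ hab hx hxb
  obtain ⟨hμb, hμb'⟩ := hμ hb₀.le le_rfl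
  have hq : 81 / 100 ≤ √(2 / 3 : ℝ) := Real.le_sqrt_of_sq_le (by norm_num)
  have hq' : √(2 / 3 : ℝ) ≤ 9 / 10 := Real.sqrt_le_iff.2 (by norm_num)
  set s₀ : ℝ := √(2 / 3) * muf a n b * b with hs₀
  have hlo : 4 / 5 * b ≤ s₀ := by
    have : 4 / 5 ≤ √(2 / 3) * muf a n b := by nlinarith
    rw [hs₀]; gcongr
  have hhi : s₀ ≤ 9 / 10 * b := by
    have : √(2 / 3) * muf a n b ≤ 9 / 10 := by nlinarith
    rw [hs₀]; gcongr
  have hball {s : ℝ} (hs : s ∈ Metric.closedBall s₀ (2 / 5 * b)) :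
      2 / 5 * b ≤ s ∧ s ≤ 13 / 10 * b := by
    rw [Real.closedBall_eq_Icc] at hs
    exact ⟨by linarith [hs.1], by linarith [hs.2]⟩
  obtain ⟨s, hsb, hs⟩ := exists_backward_solution (f := cbrtField a n) (s₀ := s₀)
    (R := 2 / 5 * b) (L := 2 / 5) hb₀.le (by norm_num)
    (contDiffOn_cbrtField fun p hp => ⟨by linarith [(hμ hp.1.1 hp.1.2).1],
      by linarith [(hball hp.2).1]⟩)
    (fun x hx s hs => by
      obtain ⟨h₁, h₂⟩ := cbrtField_mem_Icc hn ha hb₀ hb₁ hab hx.1 hx.2 (hball hs).1 (hball hs).2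
      exact abs_le.2 ⟨h₁, by linarith⟩) le_rfl
  have hcont : ContinuousOn s (Set.Icc 0 b) := fun x hx => (hs x hx).2.continuousWithinAt
  have hanti : AntitoneOn s (Set.Icc 0 b) := by
    refine antitoneOn_of_hasDerivWithinAt_nonpos (convex_Icc 0 b) hcont
      (fun x hx => (hs x (interior_subset hx)).2.mono interior_subset) fun x hx => ?_
    have hx' := interior_subset hx
    obtain ⟨h₁, h₂⟩ := hball (hs x hx').1
    exact (cbrtField_mem_Icc hn ha hb₀ hb₁ hab hx'.1 hx'.2 h₁ h₂).2
  have hge {x : ℝ} (hx : x ∈ Set.Icc 0 b) : 4 / 5 * b ≤ s x := by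
    have := hanti hx ⟨hb₀.le, le_rfl⟩ hx.2
    linarith
  refine ⟨fun x => (1 - s x ^ 3) / muf a n x, ?_, fun x hx₀ hxb => ⟨?_, ?_⟩, 1 - s 0 ^ 3,
    ?_, ?_, ?_⟩
  · simp only [hsb, hs₀, t0f, rpow_three_halves (show (0 : ℝ) ≤ 2 / 3 by norm_num)]
    ring
  · have hx : x ∈ Set.Icc 0 b := ⟨hx₀.le, hxb⟩
    exact hasDerivWithinAt_of_cbrt (by omega) (by linarith [(hμ hx.1 hx.2).1])
      (by linarith [hge hx]) ((hs x hx).2.mono Set.Ioc_subset_Icc_self)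
  · have hx : x ∈ Set.Icc 0 b := ⟨hx₀.le, hxb⟩
    obtain ⟨h₁, h₂⟩ := hμ hx.1 hx.2
    have hlt : 2 / 3 * muf a n x * x < s x := by nlinarith [hge hx]
    have hcube : (2 / 3 * muf a n x * x) ^ 3 < s x ^ 3 :=
      pow_lt_pow_left₀ hlt (by positivity) (by norm_num)
    rw [thf, one_div_mul_eq_div]
    refine div_lt_div_of_pos_right ?_ (by linarith)
    linarith [show (2 / 3 * muf a n x * x) ^ 3 = 8 / 27 * muf a n x ^ 3 * x ^ 3 by ring]
  · have hμ0 : muf a n 0 = 1 := by simp [muf, show n ≠ 0 by omega]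
    have hs0 : Filter.Tendsto s (nhdsWithin 0 (Set.Ioi 0)) (nhds (s 0)) :=
      (hcont 0 ⟨le_rfl, hb₀.le⟩).mono_left
        (nhdsWithin_le_of_mem (Icc_mem_nhdsGT hb₀))
    have hm : Filter.Tendsto (muf a n) (nhdsWithin 0 (Set.Ioi 0)) (nhds (muf a n 0)) :=
      (hasDerivAt_muf a n 0).continuousAt.mono_left nhdsWithin_le_nhds
    simpa [hμ0, Pi.div_def] using ((hs0.pow 3).const_sub 1).div hm (by simp [hμ0])
  · have : 0 < s 0 := by linarith [hge ⟨le_rfl, hb₀.le⟩]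
    have := pow_pos this 3
    linarith
  · simp [tsf, muf, show n ≠ 0 by omega]
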